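/- Let K : ℝ → ℝ be continuous and without conjugate points with K(t) > −k² for all t ∈ ℝ for some k > 0, for r > 0 let J^r be the unique solution of the Jacobi equation with J^r(0) = 1 and J^r(r) = 0, and let J^{+∞} be the solution with J^{+∞}(0) = 1 and (J^{+∞})'(0) = lim_{r→+∞} (J^r)'(0) (this limit exists). If J : ℝ → ℝ is a solution of the Jacobi equation and there exists A > 0 with |J(t)| ≤ A for all t ≥ 0, then J(t) = J(0)·J^{+∞}(t) for all t ∈ ℝ; in particular J'(0) = J(0)·(J^{+∞})'(0). -/

import Mathlib

open Set MeasureTheory Filter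

/-- A solution of the scalar Jacobi equation `J'' + K·J = 0`. -/
def IsJacobiSolution (K J : ℝ → ℝ) : Prop :=
  ContDiff ℝ 2 J ∧ ∀ t : ℝ, deriv (deriv J) t + K t * J t = 0

/-- `K` is without conjugate points: any solution vanishing at two distinct
points vanishes identically. -/
def WithoutConjugatePoints (K : ℝ → ℝ) : Prop :=
  ∀ J : ℝ → ℝ, IsJacobiSolution K J →
    ∀ a b : ℝ, a ≠ b → J a = 0 → J b = 0 → ∀ t : ℝ, J t = 0

namespace IsJacobiSolution

variable {K f g : ℝ → ℝ}

theorem hasDerivAt (hf : IsJacobiSolution K f) (t : ℝ) : HasDerivAt f (deriv f t) t :=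
  (hf.1.differentiable (by norm_num) t).hasDerivAt

theorem hasDerivAt_deriv (hf : IsJacobiSolution K f) (t : ℝ) :
    HasDerivAt (deriv f) (-(K t * f t)) t := by
  have h1 : ContDiff ℝ 1 (deriv f) := (contDiff_succ_iff_deriv (n := 1).1 hf.1).2.2
  have h2 := (h1.differentiable (by norm_num) t).hasDerivAt
  rwa [show deriv (deriv f) t = -(K t * f t) by linarith [hf.2 t]] at h2

theorem deriv_linear_comb (hf : IsJacobiSolution K f) (hg : IsJacobiSolution K g) (a b : ℝ) :
    deriv (fun t => a * f t + b * g t) = fun t => a * deriv f t + b * deriv g t :=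
  funext fun t => (((hf.hasDerivAt t).const_mul a).add ((hg.hasDerivAt t).const_mul b)).deriv

theorem linear_comb (hf : IsJacobiSolution K f) (hg : IsJacobiSolution K g) (a b : ℝ) :
    IsJacobiSolution K (fun t => a * f t + b * g t) := by
  refine ⟨(contDiff_const.mul hf.1).add (contDiff_const.mul hg.1), fun t => ?_⟩
  have h : deriv (fun t => a * deriv f t + b * deriv g t) t = _ :=
    (((hf.hasDerivAt_deriv t).const_mul a).add ((hg.hasDerivAt_deriv t).const_mul b)).deriv
  rw [deriv_linear_comb hf hg, h]
  ring

/-- The Wronskian of two solutions is constant. -/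
theorem wronskian_eq (hf : IsJacobiSolution K f) (hg : IsJacobiSolution K g) (s t : ℝ) :
    deriv f s * g s - f s * deriv g s = deriv f t * g t - f t * deriv g t := by
  have h (x : ℝ) : HasDerivAt (fun x => deriv f x * g x - f x * deriv g x) 0 x :=
    (((hf.hasDerivAt_deriv x).mul (hg.hasDerivAt x)).sub
      ((hf.hasDerivAt x).mul (hg.hasDerivAt_deriv x))).congr_deriv (by ring)
  exact is_const_of_deriv_eq_zero (fun x => (h x).differentiableAt) (fun x => (h x).deriv) s t

theorem hasDerivAt_div (hf : IsJacobiSolution K f) (hg : IsJacobiSolution K g) (s : ℝ) {t : ℝ}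
    (ht : g t ≠ 0) :
    HasDerivAt (fun x => f x / g x) ((deriv f s * g s - f s * deriv g s) / g t ^ 2) t := by
  rw [hf.wronskian_eq hg s t]
  exact (hf.hasDerivAt t).div (hg.hasDerivAt t) ht

/-- Without conjugate points, a solution with vanishing Cauchy data at `0` is zero. It is compared
with a solution `g` that does not vanish at `0`. -/
theorem eq_zero_of_cauchy_data (hwcp : WithoutConjugatePoints K) (hf : IsJacobiSolution K f)
    (hg : IsJacobiSolution K g) (hg0 : g 0 ≠ 0) (hf0 : f 0 = 0) (hf0' : deriv f 0 = 0) (t : ℝ) :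
    f t = 0 := by
  obtain ⟨ε, hε, hball⟩ := Metric.eventually_nhds_iff.1
    (hg.1.continuous.continuousAt.eventually_ne hg0)
  have hne (x : ℝ) (hx : x ∈ Icc 0 (ε / 2)) : g x ≠ 0 := hball <| by
    rw [Real.dist_eq, sub_zero, abs_of_nonneg hx.1]
    linarith [hx.2]
  have hε2 : (0 : ℝ) < ε / 2 := half_pos hε
  obtain ⟨c, hc, hslope⟩ := exists_hasDerivAt_eq_slope (fun x => f x / g x) _ hε2
    (fun x hx => (hf.hasDerivAt_div hg 0 (hne x hx)).continuousAt.continuousWithinAt)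
    (fun x hx => hf.hasDerivAt_div hg 0 (hne x (Ioo_subset_Icc_self hx)))
  have hend : f (ε / 2) = 0 := by
    have hgε := hne _ (right_mem_Icc.2 hε2.le)
    simpa [hf0, hf0', hε.ne', hgε] using hslope.symm
  exact hwcp f hf 0 (ε / 2) hε2.ne hf0 hend t

/-- If the quotient `f / g` of two solutions tends to `0` at infinity while `g` is eventually
nonzero and bounded, then the Wronskian of `f` and `g` vanishes. -/
theorem wronskian_eq_zero_of_tendsto_div (hf : IsJacobiSolution K f) (hg : IsJacobiSolution K g)
    (hlim : Tendsto (fun t => f t / g t) atTop (nhds 0)) (hne : ∀ᶠ t in atTop, g t ≠ 0)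
    {B : ℝ} (hB : ∀ᶠ t in atTop, |g t| ≤ B) (s : ℝ) :
    deriv f s * g s - f s * deriv g s = 0 := by
  set w := deriv f s * g s - f s * deriv g s with hw
  by_contra hw0
  obtain ⟨t₀, hne₀, hB₀⟩ := (hne.and hB).exists
  have hBpos : 0 < B := (abs_pos.2 hne₀).trans_le hB₀
  set m := |w| / B ^ 2 with hm
  have hmpos : 0 < m := by positivity
  have hsmall : ∀ᶠ t in atTop, |f t / g t| < m / 2 := by
    simpa only [Real.dist_eq, sub_zero] using Metric.tendsto_nhds.1 hlim (m / 2) (half_pos hmpos)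
  obtain ⟨T, hT⟩ := eventually_atTop.1 ((hne.and hB).and hsmall)
  have hder (x : ℝ) (hx : T ≤ x) := hf.hasDerivAt_div hg s (hT x hx).1.1
  obtain ⟨c, hc, hslope⟩ := exists_hasDerivAt_eq_slope (fun x => f x / g x) _ (lt_add_one T)
    (fun x hx => (hder x hx.1).continuousAt.continuousWithinAt) (fun x hx => hder x hx.1.le)
  obtain ⟨⟨hcne, hcB⟩, -⟩ := hT c hc.1.le
  have hlow : m ≤ |w / g c ^ 2| := by
    rw [abs_div, abs_pow, hm]
    have := abs_pos.2 hcne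
    gcongr
  rw [← hw, add_sub_cancel_left, div_one] at hslope
  rw [hslope] at hlow
  linarith [abs_sub (f (T + 1) / g (T + 1)) (f T / g T), (hT T le_rfl).2,
    (hT (T + 1) (by linarith)).2]

end IsJacobiSolution

theorem stmt_15 (K : ℝ → ℝ) (hK : Continuous K)
    (hwcp : WithoutConjugatePoints K) (k : ℝ) (hk : 0 < k)
    (hKk : ∀ t : ℝ, -k ^ 2 < K t)
    (Jfam : ℝ → ℝ → ℝ)
    (hJfam : ∀ r : ℝ, 0 < r →
      IsJacobiSolution K (Jfam r) ∧ Jfam r 0 = 1 ∧ Jfam r r = 0)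
    (Jinf : ℝ → ℝ) (hJinf : IsJacobiSolution K Jinf) (hJinf0 : Jinf 0 = 1)
    (hJinf0' : Tendsto (fun r => deriv (Jfam r) 0) atTop (nhds (deriv Jinf 0)))
    (J : ℝ → ℝ) (hJ : IsJacobiSolution K J)
    (A : ℝ) (hA : 0 < A) (hbdd : ∀ t : ℝ, 0 ≤ t → |J t| ≤ A) :
    (∀ t : ℝ, J t = J 0 * Jinf t) ∧ deriv J 0 = J 0 * deriv Jinf 0 := by
  have hD : IsJacobiSolution K (fun t => 1 * J t + -J 0 * Jinf t) := hJ.linear_comb hJinf 1 (-J 0)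
  set D : ℝ → ℝ := fun t => 1 * J t + -J 0 * Jinf t with hDdef
  have hDJ (t : ℝ) : D t = J t - J 0 * Jinf t := by simp only [hDdef]; ring
  have hD0 : D 0 = 0 := by rw [hDJ, hJinf0]; ring
  have hne0 : Jinf 0 ≠ 0 := hJinf0 ▸ one_ne_zero
  have hDzero : deriv D 0 = 0 := by
    by_contra hw
    have hDne (t : ℝ) (ht : 0 < t) : D t ≠ 0 := fun hDt => hw <| by
      rw [show D = fun _ => 0 from funext (hwcp D hD 0 t ht.ne hD0 hDt), deriv_const]
    have hquot (r : ℝ) (hr : 0 < r) :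
        Jinf r / D r = (deriv Jinf 0 - deriv (Jfam r) 0) / deriv D 0 := by
      obtain ⟨hJr, hJr0, hJrr⟩ := hJfam r hr
      have hdiff := hJr.linear_comb hJinf 1 (-1)
      have hzero := (hdiff.linear_comb hD (deriv D 0)
        (deriv Jinf 0 - deriv (Jfam r) 0)).eq_zero_of_cauchy_data hwcp hJinf hne0
        (by simp only [hJr0, hJinf0, hD0]; ring)
        (by rw [hdiff.deriv_linear_comb hD, hJr.deriv_linear_comb hJinf]; ring) r
      rw [hJrr] at hzero
      rw [div_eq_div_iff (hDne r hr) hw]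
      linarith
    have hlim : Tendsto (fun t => Jinf t / D t) atTop (nhds 0) := by
      have h := (hJinf0'.const_sub (deriv Jinf 0)).div_const (deriv D 0)
      rw [sub_self, zero_div] at h
      exact h.congr' ((eventually_gt_atTop 0).mono fun r hr => (hquot r hr).symm)
    have hbound : ∀ᶠ t in atTop, |D t| ≤ 2 * A := by
      have h := hlim.const_mul (J 0)
      rw [mul_zero] at h
      filter_upwards [Metric.tendsto_nhds.1 h (1 / 2) (by norm_num), eventually_gt_atTop 0]
        with t ht htpos
      rw [Real.dist_eq, sub_zero, ← mul_div_assoc, abs_div,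
        div_lt_iff₀ (abs_pos.2 (hDne t htpos))] at ht
      have := abs_sub (J t) (J 0 * Jinf t)
      rw [← hDJ] at this
      linarith [hbdd t htpos.le]
    have hwr := hJinf.wronskian_eq_zero_of_tendsto_div hD hlim
      ((eventually_gt_atTop 0).mono hDne) hbound 0
    simp [hD0, hJinf0, hw] at hwr
  refine ⟨fun t => ?_, ?_⟩
  · linarith [hDJ t, hD.eq_zero_of_cauchy_data hwcp hJinf hne0 hD0 hDzero t]
  · rw [hDdef, hJ.deriv_linear_comb hJinf] at hDzero
    linarith
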